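/- Granville–Hoffman–Ohno identities: for any integer l ≥ 4, Σ_{l1≥2, l3≥1, l1+l3=l-1} ζ(l1,1,l3) = ζ(l-1,1) + ζ(2,l-2), and Σ_{l1≥2, l2≥1, l1+l2=l-1} ζ(l1,l2,1) = ζ(l-1,1) + ζ(l-2,2). -/

import Mathlib

/-- Riemann zeta value -/
noncomputable def rz (l : ℕ) : ℝ :=
  ∑' m : ℕ, if 0 < m then 1 / (m : ℝ) ^ l else 0

/-- double zeta value -/
noncomputable def dz (a b : ℕ) : ℝ :=
  ∑' p : ℕ × ℕ, if p.2 < p.1 ∧ 0 < p.2 then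
    1 / ((p.1 : ℝ) ^ a * (p.2 : ℝ) ^ b) else 0

/-- triple zeta value -/
noncomputable def tz (a b c : ℕ) : ℝ :=
  ∑' t : ℕ × ℕ × ℕ, if t.2.1 < t.1 ∧ t.2.2 < t.2.1 ∧ 0 < t.2.2 then
    1 / ((t.1 : ℝ) ^ a * (t.2.1 : ℝ) ^ b * (t.2.2 : ℝ) ^ c) else 0

/-- admissible triple indices of weight l -/
def TIdx (l : ℕ) : Finset (ℕ × ℕ × ℕ) :=
  (Finset.range (l + 1) ×ˢ Finset.range (l + 1) ×ˢ Finset.range (l + 1)).filter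
    (fun t => 2 ≤ t.1 ∧ 1 ≤ t.2.1 ∧ 1 ≤ t.2.2 ∧ t.1 + t.2.1 + t.2.2 = l)

open Finset Filter Topology

/-- The harmonic number `H_{n-1}`, written with the convention `1 / 0 = 0`. -/
noncomputable def hsum (n : ℕ) : ℝ := ∑ k ∈ range n, 1 / (k : ℝ)

/-- The sum of `f m n k` over all `m > n > k > 0`, as an extended nonnegative real. -/
noncomputable def tripleSum (f : ℕ → ℕ → ℕ → ℝ) : ENNReal :=
  ∑' m : ℕ, ∑' n : ℕ, ∑' k : ℕ,
    if n < m ∧ k < n ∧ 0 < k then ENNReal.ofReal (f m n k) else 0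

/-- The sum of `f m n` over all `m > n > 0`, as an extended nonnegative real. -/
noncomputable def doubleSum (f : ℕ → ℕ → ℝ) : ENNReal :=
  ∑' m : ℕ, ∑' n : ℕ, if n < m ∧ 0 < n then ENNReal.ofReal (f m n) else 0

theorem tz_eq_toReal (a b c : ℕ) :
    tz a b c = (tripleSum fun m n k => 1 / ((m : ℝ) ^ a * (n : ℝ) ^ b * (k : ℝ) ^ c)).toReal := by
  have h : (tripleSum fun m n k => 1 / ((m : ℝ) ^ a * (n : ℝ) ^ b * (k : ℝ) ^ c)) =
      ∑' t : ℕ × ℕ × ℕ, if t.2.1 < t.1 ∧ t.2.2 < t.2.1 ∧ 0 < t.2.2 then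
        ENNReal.ofReal (1 / ((t.1 : ℝ) ^ a * (t.2.1 : ℝ) ^ b * (t.2.2 : ℝ) ^ c)) else 0 := by
    rw [tripleSum, ENNReal.tsum_prod']
    refine tsum_congr fun m => ?_
    rw [ENNReal.tsum_prod']
  rw [h, ENNReal.tsum_toReal_eq]
  · refine tsum_congr fun t => ?_
    split_ifs
    · rw [ENNReal.toReal_ofReal (by positivity)]
    · simp
  · intro t
    split_ifs
    · exact ENNReal.ofReal_ne_top
    · exact ENNReal.zero_ne_top

theorem dz_eq_toReal (a b : ℕ) :
    dz a b = (doubleSum fun m n => 1 / ((m : ℝ) ^ a * (n : ℝ) ^ b)).toReal := by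
  have h : (doubleSum fun m n => 1 / ((m : ℝ) ^ a * (n : ℝ) ^ b)) =
      ∑' t : ℕ × ℕ, if t.2 < t.1 ∧ 0 < t.2 then
        ENNReal.ofReal (1 / ((t.1 : ℝ) ^ a * (t.2 : ℝ) ^ b)) else 0 := by
    rw [doubleSum, ENNReal.tsum_prod']
  rw [h, ENNReal.tsum_toReal_eq]
  · refine tsum_congr fun t => ?_
    split_ifs
    · rw [ENNReal.toReal_ofReal (by positivity)]
    · simp
  · intro t
    split_ifs
    · exact ENNReal.ofReal_ne_top
    · exact ENNReal.zero_ne_top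

theorem tripleSum_congr {f g : ℕ → ℕ → ℕ → ℝ}
    (h : ∀ m n k, n < m → k < n → 0 < k → f m n k = g m n k) : tripleSum f = tripleSum g := by
  refine tsum_congr fun m => tsum_congr fun n => tsum_congr fun k => ?_
  split_ifs with hc
  · rw [h m n k hc.1 hc.2.1 hc.2.2]
  · rfl

theorem tripleSum_add {f g : ℕ → ℕ → ℕ → ℝ}
    (hf : ∀ m n k, n < m → k < n → 0 < k → 0 ≤ f m n k)
    (hg : ∀ m n k, n < m → k < n → 0 < k → 0 ≤ g m n k) :
    tripleSum (fun m n k => f m n k + g m n k) = tripleSum f + tripleSum g := by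
  simp only [tripleSum, ← ENNReal.tsum_add]
  refine tsum_congr fun m => tsum_congr fun n => tsum_congr fun k => ?_
  split_ifs with hc
  · rw [ENNReal.ofReal_add (hf m n k hc.1 hc.2.1 hc.2.2) (hg m n k hc.1 hc.2.1 hc.2.2)]
  · simp

theorem tripleSum_sum {ι : Type*} (s : Finset ι) {f : ι → ℕ → ℕ → ℕ → ℝ}
    (hf : ∀ i m n k, 0 ≤ f i m n k) :
    tripleSum (fun m n k => ∑ i ∈ s, f i m n k) = ∑ i ∈ s, tripleSum (f i) := by
  classical
  induction s using Finset.induction_on with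
  | empty => simp [tripleSum]
  | insert i s hi ih =>
    simp only [Finset.sum_insert hi]
    rw [tripleSum_add (fun m n k _ _ _ => hf i m n k)
      (fun m n k _ _ _ => Finset.sum_nonneg fun j _ => hf j m n k), ih]

theorem tsum_ite_lt_eq_sum_range (m : ℕ) (f : ℕ → ENNReal) :
    (∑' k : ℕ, if k < m then f k else 0) = ∑ k ∈ range m, f k := by
  rw [tsum_eq_sum (s := range m) (fun k hk => by simp_all)]
  exact Finset.sum_congr rfl fun k hk => by simp_all

theorem tsum_ofReal_of_hasSum {f : ℕ → ℝ} {a : ℝ} (hf : ∀ n, 0 ≤ f n) (h : HasSum f a) :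
    ∑' n, ENNReal.ofReal (f n) = ENNReal.ofReal a := by
  rw [← ENNReal.ofReal_tsum_of_nonneg hf h.summable, h.tsum_eq]

theorem hsum_succ (n : ℕ) : hsum (n + 1) = hsum n + 1 / (n : ℝ) := by
  simp [hsum, Finset.sum_range_succ]

theorem hsum_nonneg (n : ℕ) : 0 ≤ hsum n := Finset.sum_nonneg fun _ _ => by positivity

theorem sum_one_div_sub (n : ℕ) : ∑ s ∈ range n, 1 / ((n : ℝ) - s) = hsum (n + 1) := by
  rw [hsum, Finset.sum_range_succ', ← Finset.sum_range_reflect]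
  simp only [Nat.cast_zero, div_zero, add_zero]
  refine Finset.sum_congr rfl fun j hj => ?_
  have hj := Finset.mem_range.1 hj
  rw [Nat.sub_sub, Nat.cast_sub (by omega)]
  push_cast
  congr 1
  ring

theorem hsum_succ_eq_harmonic (n : ℕ) : hsum (n + 1) = (harmonic n : ℝ) := by
  rw [hsum, Finset.sum_range_succ', harmonic]
  simp

theorem summable_hsum_sq_div_sq :
    Summable fun m : ℕ => 1 / (m : ℝ) ^ 2 * (hsum (m + 1) * hsum (m + 1)) := by
  have hs : Summable fun m : ℕ => 25 * (1 / (m : ℝ) ^ (3 / 2 : ℝ)) :=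
    (Real.summable_one_div_nat_rpow.2 (by norm_num)).mul_left 25
  refine Summable.of_nonneg_of_le (fun m => ?_) (fun m => ?_) hs
  · have := hsum_nonneg (m + 1)
    positivity
  · rcases Nat.eq_zero_or_pos m with rfl | hm
    · simp
    have hm' : (1 : ℝ) ≤ m := by exact_mod_cast hm
    have hm0 : (0 : ℝ) < m := by linarith
    have h1 : hsum (m + 1) ≤ 1 + Real.log m := by
      rw [hsum_succ_eq_harmonic]
      exact harmonic_le_one_add_log m
    have h2 := Real.log_le_rpow_div hm0.le (show (0 : ℝ) < 1 / 4 by norm_num)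
    have h3 := Real.one_le_rpow hm' (show (0 : ℝ) ≤ 1 / 4 by norm_num)
    have h4 : hsum (m + 1) ≤ 5 * (m : ℝ) ^ (1 / 4 : ℝ) := by linarith
    have h5 : hsum (m + 1) * hsum (m + 1) ≤ 25 * (m : ℝ) ^ (1 / 2 : ℝ) := by
      calc hsum (m + 1) * hsum (m + 1)
          ≤ (5 * (m : ℝ) ^ (1 / 4 : ℝ)) * (5 * (m : ℝ) ^ (1 / 4 : ℝ)) :=
            mul_le_mul h4 h4 (hsum_nonneg _) (by positivity)
        _ = 25 * ((m : ℝ) ^ (1 / 4 : ℝ) * (m : ℝ) ^ (1 / 4 : ℝ)) := by ring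
        _ = _ := by rw [← Real.rpow_add hm0]; norm_num
    have h6 : (m : ℝ) ^ (1 / 2 : ℝ) * (m : ℝ) ^ (3 / 2 : ℝ) = (m : ℝ) ^ 2 := by
      rw [← Real.rpow_add hm0]
      norm_num
    have h7 : (0 : ℝ) < (m : ℝ) ^ (3 / 2 : ℝ) := by positivity
    calc 1 / (m : ℝ) ^ 2 * (hsum (m + 1) * hsum (m + 1))
        ≤ 1 / (m : ℝ) ^ 2 * (25 * (m : ℝ) ^ (1 / 2 : ℝ)) := by gcongr
      _ = _ := by
        rw [← h6]
        have : (0 : ℝ) < (m : ℝ) ^ (1 / 2 : ℝ) := by positivity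
        field_simp

theorem tripleSum_ne_top {f : ℕ → ℕ → ℕ → ℝ} (u v : ℕ → ℕ → ℝ)
    (hu : ∀ m n, n < m → 0 ≤ u m n) (hv : ∀ m n, n < m → 0 ≤ v m n)
    (hu' : ∀ m, ∑ n ∈ range m, u m n ≤ hsum (m + 1))
    (hv' : ∀ m, ∑ n ∈ range m, v m n ≤ hsum (m + 1))
    (hf : ∀ m n k, n < m → k < n → 0 < k → f m n k ≤ 1 / (m : ℝ) ^ 2 * (u m n * v m k)) :
    tripleSum f ≠ ⊤ := by
  have hle : tripleSum f ≤
      ∑' m : ℕ, ENNReal.ofReal (1 / (m : ℝ) ^ 2 * (hsum (m + 1) * hsum (m + 1))) := by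
    refine ENNReal.tsum_le_tsum fun m => ?_
    calc _ ≤ ∑' n : ℕ, if n < m then ∑' k : ℕ, (if k < m then
            ENNReal.ofReal (1 / (m : ℝ) ^ 2 * (u m n * v m k)) else 0) else 0 := by
          refine ENNReal.tsum_le_tsum fun n => ?_
          by_cases hn : n < m
          · simp only [hn, true_and, if_true]
            refine ENNReal.tsum_le_tsum fun k => ?_
            by_cases hk : k < n ∧ 0 < k
            · rw [if_pos hk, if_pos (hk.1.trans hn)]
              exact ENNReal.ofReal_le_ofReal (hf m n k hn hk.1 hk.2)
            · simp [hk]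
          · simp [hn]
      _ = ENNReal.ofReal (1 / (m : ℝ) ^ 2 *
            ((∑ n ∈ range m, u m n) * ∑ k ∈ range m, v m k)) := by
          simp only [tsum_ite_lt_eq_sum_range]
          rw [Finset.sum_mul_sum, Finset.mul_sum, ENNReal.ofReal_sum_of_nonneg]
          · refine Finset.sum_congr rfl fun n hn => ?_
            rw [Finset.mul_sum, ENNReal.ofReal_sum_of_nonneg]
            intro k hk
            have := hu m n (by simpa using hn)
            have := hv m k (by simpa using hk)
            positivity
          · intro n hn
            refine mul_nonneg (by positivity) (Finset.sum_nonneg fun k hk => ?_)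
            exact mul_nonneg (hu m n (by simpa using hn)) (hv m k (by simpa using hk))
      _ ≤ _ := by
          refine ENNReal.ofReal_le_ofReal (mul_le_mul_of_nonneg_left ?_ (by positivity))
          exact mul_le_mul (hu' m) (hv' m)
            (Finset.sum_nonneg fun k hk => hv m k (by simpa using hk)) (hsum_nonneg _)
  refine ne_top_of_le_ne_top ?_ hle
  exact summable_hsum_sq_div_sq.tsum_ofReal_ne_top

theorem sum_range_one_div_le (m : ℕ) : ∑ n ∈ range m, 1 / (n : ℝ) ≤ hsum (m + 1) := by
  rw [hsum_succ, hsum]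
  have : (0 : ℝ) ≤ 1 / m := by positivity
  linarith

theorem one_div_sub_nonneg (m n : ℕ) (h : n < m) : (0 : ℝ) ≤ 1 / ((m : ℝ) - n) := by
  have : (n : ℝ) < m := by exact_mod_cast h
  exact one_div_nonneg.2 (by linarith)

theorem hasSum_of_forall_eq {f g : ℕ → ℝ} {a : ℝ} (h : HasSum f a) (hfg : ∀ n, f n = g n) :
    HasSum g a :=
  funext hfg ▸ h

theorem hasSum_ite_lt {n : ℕ} {f : ℕ → ℝ} {a : ℝ} (h : HasSum (fun r => f (r + (n + 1))) a) :
    HasSum (fun m => if n < m then f m else 0) a := by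
  rw [← hasSum_nat_add_iff' (n + 1)]
  have h0 : ∑ i ∈ range (n + 1), (if n < i then f i else 0) = 0 :=
    Finset.sum_eq_zero fun i hi => if_neg (by have := Finset.mem_range.1 hi; omega)
  rw [h0, sub_zero]
  refine hasSum_of_forall_eq h fun r => ?_
  rw [if_pos (by omega)]

theorem hasSum_one_div_sub_one_div_succ {i n : ℕ} (h : i < n) :
    HasSum (fun m : ℕ => if n < m then 1 / ((m : ℝ) - i - 1) - 1 / ((m : ℝ) - i) else 0)
      (1 / ((n : ℝ) - i)) := by
  apply hasSum_ite_lt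
  have hi : (i : ℝ) < n := by exact_mod_cast h
  rw [hasSum_iff_tendsto_nat_of_nonneg]
  · have hs : ∀ R : ℕ, ∑ r ∈ range R, (1 / (((r + (n + 1) : ℕ) : ℝ) - i - 1) -
        1 / (((r + (n + 1) : ℕ) : ℝ) - i)) = 1 / ((n : ℝ) - i) - 1 / ((R : ℝ) + (n - i)) := by
      intro R
      induction R with
      | zero => simp
      | succ R ih =>
        rw [Finset.sum_range_succ, ih]
        push_cast
        ring_nf
    simp only [hs]
    have ht : Tendsto (fun R : ℕ => 1 / ((R : ℝ) + ((n : ℝ) - i))) atTop (𝓝 0) :=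
      tendsto_const_nhds.div_atTop
        (tendsto_atTop_add_const_right _ _ tendsto_natCast_atTop_atTop)
    simpa using ht.const_sub (1 / ((n : ℝ) - i))
  · intro r
    have hr : (0 : ℝ) ≤ r := r.cast_nonneg
    push_cast
    rw [sub_nonneg]
    exact one_div_le_one_div_of_le (by linarith) (by linarith)

theorem hasSum_one_div_sub_one_div {i n : ℕ} (h : i ≤ n) :
    HasSum (fun m : ℕ => if n < m then 1 / ((m : ℝ) - i) - 1 / (m : ℝ) else 0)
      (∑ s ∈ range i, 1 / ((n : ℝ) - s)) := by
  induction i with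
  | zero => simp
  | succ i ih =>
    rw [Finset.sum_range_succ]
    refine hasSum_of_forall_eq
      ((ih (by omega)).add (hasSum_one_div_sub_one_div_succ (by omega : i < n))) fun m => ?_
    split_ifs
    · push_cast
      ring
    · simp

theorem hasSum_one_div_mul_sub {i n : ℕ} (hi : 0 < i) (h : i ≤ n) :
    HasSum (fun m : ℕ => if n < m then 1 / ((m : ℝ) * (m - i)) else 0)
      (1 / (i : ℝ) * ∑ s ∈ range i, 1 / ((n : ℝ) - s)) := by
  refine hasSum_of_forall_eq ((hasSum_one_div_sub_one_div h).mul_left (1 / (i : ℝ))) fun m => ?_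
  split_ifs with hm
  · have h1 : (i : ℝ) < m := by exact_mod_cast (by omega : i < m)
    have h2 : (0 : ℝ) < i := by exact_mod_cast hi
    have h3 : (m : ℝ) - i ≠ 0 := by linarith
    have h4 : (m : ℝ) ≠ 0 := by linarith
    field_simp
    ring
  · simp

/-- The weight-lowering geometric sum, cleared of its subtraction. -/
theorem sum_one_div_pow_add {x y : ℝ} (hx : x ≠ 0) (hy : y ≠ 0) (hxy : x - y ≠ 0) (p : ℕ) :
    ∑ a ∈ Icc 2 (p + 1), 1 / (x ^ a * y ^ (p + 2 - a)) + 1 / (x ^ (p + 1) * (x - y)) =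
      1 / (x * (x - y) * y ^ p) := by
  induction p with
  | zero => simp
  | succ p ih =>
    rw [Finset.sum_Icc_succ_top (by omega)]
    have h : ∑ a ∈ Icc 2 (p + 1), 1 / (x ^ a * y ^ (p + 1 + 2 - a)) =
        1 / y * ∑ a ∈ Icc 2 (p + 1), 1 / (x ^ a * y ^ (p + 2 - a)) := by
      rw [Finset.mul_sum]
      refine Finset.sum_congr rfl fun a ha => ?_
      have ha := Finset.mem_Icc.1 ha
      rw [show p + 1 + 2 - a = (p + 2 - a) + 1 by omega, pow_succ]
      field_simp
    rw [h, eq_sub_of_add_eq ih, show p + 1 + 2 - (p + 1 + 1) = 1 by omega]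
    field_simp
    ring

/-- `∑ 1 / (n * (k - s))` over `k > n > s > 0`. -/
noncomputable def nestedSum (k : ℕ) : ℝ :=
  ∑ n ∈ range k, ∑ s ∈ range n, if 0 < s then 1 / ((n : ℝ) * (k - s)) else 0

theorem nestedSum_nonneg (k : ℕ) : 0 ≤ nestedSum k := by
  refine Finset.sum_nonneg fun n hn => Finset.sum_nonneg fun s hs => ?_
  have := one_div_sub_nonneg k s ((Finset.mem_range.1 hs).trans (Finset.mem_range.1 hn))
  rw [← one_div_mul_one_div]
  split_ifs <;> positivity

theorem sum_one_div_mul_sum_eq (k : ℕ) :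
    ∑ n ∈ range k, 1 / (n : ℝ) * ∑ s ∈ range n, 1 / ((k : ℝ) - s) =
      nestedSum k + hsum k / k := by
  rw [nestedSum, hsum, Finset.sum_div, ← Finset.sum_add_distrib]
  refine Finset.sum_congr rfl fun n _ => ?_
  cases n with
  | zero => simp
  | succ n =>
    rw [Finset.sum_range_succ', Finset.sum_range_succ' _ n, mul_add, Finset.mul_sum]
    simp [mul_comm, div_eq_mul_inv]

theorem summable_ite_one_div_sq (k : ℕ) :
    Summable fun n : ℕ => if k < n then 1 / (n : ℝ) ^ 2 else 0 := by
  refine Summable.of_nonneg_of_le (fun n => ?_) (fun n => ?_)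
    (Real.summable_one_div_nat_pow.2 (by norm_num : 1 < 2))
  · split_ifs <;> positivity
  · split_ifs
    · exact le_rfl
    · positivity

theorem hasSum_one_div_mul_sum {k : ℕ} (hk : 0 < k) :
    HasSum (fun n : ℕ => if k < n then 1 / (n : ℝ) * ∑ s ∈ range k, 1 / ((n : ℝ) - s) else 0)
      ((∑' n : ℕ, if k < n then 1 / (n : ℝ) ^ 2 else 0) + (nestedSum k + hsum k / k)) := by
  obtain ⟨j, rfl⟩ : ∃ j, k = j + 1 := ⟨k - 1, by omega⟩
  rw [← sum_one_div_mul_sum_eq, Finset.sum_range_succ']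
  have h := (summable_ite_one_div_sq (j + 1)).hasSum.add (hasSum_sum (s := range j) fun i hi =>
    hasSum_one_div_mul_sub (Nat.succ_pos i)
      (show i + 1 ≤ j + 1 by have := Finset.mem_range.1 hi; omega))
  convert h using 2 with n
  · split_ifs
    · rw [Finset.sum_range_succ', mul_add, Finset.mul_sum, add_comm]
      simp [mul_comm, pow_two]
    · simp
  · simp

theorem sum_one_div_mul_sub (m : ℕ) :
    ∑ n ∈ range m, 1 / (n : ℝ) * (1 / ((m : ℝ) - n)) = 2 * hsum m / m := by
  have h1 : ∑ n ∈ range m, 1 / (n : ℝ) * (1 / ((m : ℝ) - n)) =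
      ∑ n ∈ range m, (1 / (m : ℝ) * (1 / (n : ℝ) + 1 / ((m : ℝ) - n)) -
        if n = 0 then 1 / (m : ℝ) * (1 / m) else 0) := by
    refine Finset.sum_congr rfl fun n hn => ?_
    have hn : (n : ℝ) < m := by exact_mod_cast Finset.mem_range.1 hn
    split_ifs with h0
    · simp [h0]
    · have : (0 : ℝ) < n := by exact_mod_cast Nat.pos_of_ne_zero h0
      have h3 : (m : ℝ) - n ≠ 0 := by linarith
      have h4 : (m : ℝ) ≠ 0 := by linarith
      field_simp
      ring
  rcases Nat.eq_zero_or_pos m with rfl | hm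
  · simp
  rw [h1, Finset.sum_sub_distrib, ← Finset.mul_sum, Finset.sum_add_distrib, sum_one_div_sub,
    hsum_succ, Finset.sum_ite_eq' (range m) 0, if_pos (by simpa using hm), ← hsum]
  ring

theorem sum_hsum_div_sub (m : ℕ) :
    ∑ n ∈ range m, hsum n * (1 / ((m : ℝ) - n)) + ∑ k ∈ range m, 1 / (k : ℝ) ^ 2 =
      hsum m ^ 2 := by
  induction m with
  | zero => simp [hsum]
  | succ m ih =>
    have h : ∑ n ∈ range (m + 1), hsum n * (1 / (((m + 1 : ℕ) : ℝ) - n)) =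
        ∑ n ∈ range m, hsum n * (1 / ((m : ℝ) - n)) + 2 * hsum m / m := by
      rw [Finset.sum_range_succ', ← sum_one_div_mul_sub, ← Finset.sum_add_distrib]
      have h0 : hsum 0 = 0 := by simp [hsum]
      rw [h0, zero_mul, add_zero]
      refine Finset.sum_congr rfl fun n _ => ?_
      rw [hsum_succ]
      push_cast
      ring
    rw [h, Finset.sum_range_succ, hsum_succ, add_sq, ← ih]
    ring

theorem doubleSum_eq_tsum {f : ℕ → ℕ → ℝ} (hf : ∀ m n, 0 ≤ f m n) (hf0 : ∀ m, f m 0 = 0) :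
    doubleSum f = ∑' m : ℕ, ENNReal.ofReal (∑ n ∈ range m, f m n) := by
  refine tsum_congr fun m => ?_
  rw [ENNReal.ofReal_sum_of_nonneg fun n _ => hf m n, ← tsum_ite_lt_eq_sum_range]
  refine tsum_congr fun n => ?_
  rcases Nat.eq_zero_or_pos n with rfl | hn
  · simp [hf0]
  · simp [hn]

theorem tripleSum_eq_tsum {f : ℕ → ℕ → ℕ → ℝ} (hf : ∀ m n k, n < m → k < n → 0 ≤ f m n k) :
    tripleSum f =
      ∑' m : ℕ, ENNReal.ofReal (∑ n ∈ range m, ∑ k ∈ range n, if 0 < k then f m n k else 0) := by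
  refine tsum_congr fun m => ?_
  have hk : ∀ n k, n < m → k < n → 0 ≤ if 0 < k then f m n k else 0 := fun n k hn hk => by
    split_ifs
    · exact hf m n k hn hk
    · exact le_rfl
  rw [ENNReal.ofReal_sum_of_nonneg fun n hn => Finset.sum_nonneg fun k hk' =>
    hk n k (by simpa using hn) (by simpa using hk'), ← tsum_ite_lt_eq_sum_range]
  refine tsum_congr fun n => ?_
  by_cases hn : n < m
  · rw [if_pos hn, ENNReal.ofReal_sum_of_nonneg fun k hk' => hk n k hn (by simpa using hk'),
      ← tsum_ite_lt_eq_sum_range]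
    refine tsum_congr fun k => ?_
    by_cases h1 : k < n <;> by_cases h2 : 0 < k <;> simp [hn, h1, h2]
  · simp [hn]

theorem doubleSum_swap {f : ℕ → ℕ → ℝ} :
    doubleSum f = ∑' n : ℕ, ∑' m : ℕ, if n < m ∧ 0 < n then ENNReal.ofReal (f m n) else 0 :=
  ENNReal.tsum_comm

theorem tripleSum_swap {f : ℕ → ℕ → ℕ → ℝ} :
    tripleSum f = ∑' k : ℕ, ∑' n : ℕ, ∑' m : ℕ,
      if n < m ∧ k < n ∧ 0 < k then ENNReal.ofReal (f m n k) else 0 := by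
  rw [tripleSum, ENNReal.tsum_comm]
  exact (tsum_congr fun n => ENNReal.tsum_comm).trans ENNReal.tsum_comm

theorem tsum_one_div_mul_sub {i n : ℕ} (hi : 0 < i) (h : i ≤ n) {c : ℝ} (hc : 0 ≤ c) :
    (∑' m : ℕ, if n < m then ENNReal.ofReal (c * (1 / ((m : ℝ) * (m - i)))) else 0) =
      ENNReal.ofReal (c * (1 / (i : ℝ) * ∑ s ∈ range i, 1 / ((n : ℝ) - s))) := by
  rw [← tsum_ofReal_of_hasSum (fun m => ?_) ((hasSum_one_div_mul_sub hi h).mul_left c)]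
  · refine tsum_congr fun m => ?_
    split_ifs <;> simp
  · split_ifs with hm
    · rw [← one_div_mul_one_div]
      have := one_div_sub_nonneg m i (by omega)
      positivity
    · simp

theorem tripleSum_outer_inner (p : ℕ) :
    tripleSum (fun m n k => 1 / (n : ℝ) * (1 / ((m : ℝ) * (m - k) * (k : ℝ) ^ p))) =
      doubleSum (fun m n => 1 / ((m : ℝ) ^ (p + 2) * (n : ℝ) ^ 1)) +
      doubleSum (fun m n => 1 / ((m : ℝ) ^ 2 * (n : ℝ) ^ (p + 1))) +
      tripleSum (fun m n k => 1 / (n : ℝ) * (1 / ((m : ℝ) ^ (p + 1) * (m - k)))) := by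
  rw [tripleSum_swap, doubleSum_eq_tsum (fun m n => by positivity) (fun m => by simp),
    doubleSum_swap, tripleSum_eq_tsum, ← ENNReal.tsum_add, ← ENNReal.tsum_add]
  · refine tsum_congr fun k => ?_
    rcases Nat.eq_zero_or_pos k with rfl | hk
    · simp
    have hk0 : (k : ℝ) ≠ 0 := by exact_mod_cast hk.ne'
    have hZ : (∑' n : ℕ, if k < n ∧ 0 < k then
        ENNReal.ofReal (1 / ((n : ℝ) ^ 2 * (k : ℝ) ^ (p + 1))) else 0) =
        ENNReal.ofReal (1 / (k : ℝ) ^ (p + 1) *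
          ∑' n : ℕ, if k < n then 1 / (n : ℝ) ^ 2 else 0) := by
      rw [← tsum_ofReal_of_hasSum (fun n => ?_)
        ((summable_ite_one_div_sq k).hasSum.mul_left (1 / (k : ℝ) ^ (p + 1)))]
      · refine tsum_congr fun n => ?_
        split_ifs <;> simp_all
      · split_ifs <;> positivity
    have hH : ∑ n ∈ range k, 1 / ((k : ℝ) ^ (p + 2) * (n : ℝ) ^ 1) =
        1 / (k : ℝ) ^ (p + 1) * (hsum k / k) := by
      rw [hsum, Finset.sum_div, Finset.mul_sum]
      refine Finset.sum_congr rfl fun n _ => ?_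
      rw [← one_div_mul_one_div]
      field_simp
      ring
    have hB : (∑ n ∈ range k, ∑ s ∈ range n,
        if 0 < s then 1 / (n : ℝ) * (1 / ((k : ℝ) ^ (p + 1) * (k - s))) else 0) =
        1 / (k : ℝ) ^ (p + 1) * nestedSum k := by
      rw [nestedSum, Finset.mul_sum]
      refine Finset.sum_congr rfl fun n _ => ?_
      rw [Finset.mul_sum]
      refine Finset.sum_congr rfl fun s _ => ?_
      split_ifs
      · simp only [one_div, mul_inv]
        ring
      · simp
    have hA : ∀ n : ℕ, (∑' m : ℕ, if n < m ∧ k < n ∧ 0 < k then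
        ENNReal.ofReal (1 / (n : ℝ) * (1 / ((m : ℝ) * (m - k) * (k : ℝ) ^ p))) else 0) =
        ENNReal.ofReal (1 / (k : ℝ) ^ (p + 1) *
          if k < n then 1 / (n : ℝ) * ∑ s ∈ range k, 1 / ((n : ℝ) - s) else 0) := by
      intro n
      by_cases hn : k < n
      · have h := tsum_one_div_mul_sub hk hn.le
          (show (0 : ℝ) ≤ 1 / (n : ℝ) * (1 / (k : ℝ) ^ p) by positivity)
        simp only [hn, hk, and_true, if_true]
        convert h using 1
        · refine tsum_congr fun m => ?_
          congr 2
          simp only [one_div, mul_inv]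
          ring
        · congr 1
          rw [pow_succ]
          simp only [one_div, mul_inv]
          ring
      · simp [hn]
    have hZ0 : (0 : ℝ) ≤ ∑' n : ℕ, if k < n then 1 / (n : ℝ) ^ 2 else 0 :=
      tsum_nonneg fun n => by split_ifs <;> positivity
    have hH0 := hsum_nonneg k
    have hB0 := nestedSum_nonneg k
    rw [hZ, hH, hB, tsum_congr hA, tsum_ofReal_of_hasSum (fun n => ?_)
      ((hasSum_one_div_mul_sum hk).mul_left _), ← ENNReal.ofReal_add (by positivity) (by positivity),
      ← ENNReal.ofReal_add (by positivity) (by positivity)]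
    · congr 1
      ring
    · split_ifs with hn
      · refine mul_nonneg (by positivity) (mul_nonneg (by positivity) ?_)
        exact Finset.sum_nonneg fun s hs =>
          one_div_sub_nonneg n s (by have := Finset.mem_range.1 hs; omega)
      · simp
  · intro m n k hn hk
    have := one_div_sub_nonneg m k (by omega)
    rw [← one_div_mul_one_div]
    positivity

theorem tripleSum_outer_middle (p : ℕ) :
    tripleSum (fun m n k => 1 / (k : ℝ) * (1 / ((m : ℝ) * (m - n) * (n : ℝ) ^ p))) =
      doubleSum (fun m n => 1 / ((m : ℝ) ^ (p + 2) * (n : ℝ) ^ 1)) +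
      doubleSum (fun m n => 1 / ((m : ℝ) ^ (p + 1) * (n : ℝ) ^ 2)) +
      tripleSum (fun m n k => 1 / (k : ℝ) * (1 / ((m : ℝ) ^ (p + 1) * (m - n)))) := by
  have hl : tripleSum (fun m n k => 1 / (k : ℝ) * (1 / ((m : ℝ) * (m - n) * (n : ℝ) ^ p))) =
      ∑' n : ℕ, ∑' k : ℕ, ∑' m : ℕ, if n < m ∧ k < n ∧ 0 < k then
        ENNReal.ofReal (1 / (k : ℝ) * (1 / ((m : ℝ) * (m - n) * (n : ℝ) ^ p))) else 0 := by
    rw [tripleSum, ENNReal.tsum_comm]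
    exact tsum_congr fun n => ENNReal.tsum_comm
  rw [hl, doubleSum_eq_tsum (fun m n => by positivity) (fun m => by simp),
    doubleSum_eq_tsum (fun m n => by positivity) (fun m => by simp),
    tripleSum_eq_tsum, ← ENNReal.tsum_add, ← ENNReal.tsum_add]
  · refine tsum_congr fun n => ?_
    rcases Nat.eq_zero_or_pos n with rfl | hn
    · simp
    have hn0 : (n : ℝ) ≠ 0 := by exact_mod_cast hn.ne'
    have hA : ∀ k : ℕ, (∑' m : ℕ, if n < m ∧ k < n ∧ 0 < k then
        ENNReal.ofReal (1 / (k : ℝ) * (1 / ((m : ℝ) * (m - n) * (n : ℝ) ^ p))) else 0) =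
        if k < n then ENNReal.ofReal
          (1 / (n : ℝ) ^ (p + 1) * hsum (n + 1) * (1 / (k : ℝ))) else 0 := by
      intro k
      by_cases hk : k < n
      · rcases Nat.eq_zero_or_pos k with rfl | hk0
        · simp
        have h := tsum_one_div_mul_sub hn le_rfl
          (show (0 : ℝ) ≤ 1 / (k : ℝ) * (1 / (n : ℝ) ^ p) by positivity)
        simp only [hk, hk0, and_true, if_true]
        rw [sum_one_div_sub] at h
        convert h using 1
        · refine tsum_congr fun m => ?_
          congr 2
          simp only [one_div, mul_inv]
          ring
        · congr 1
          rw [pow_succ]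
          simp only [one_div, mul_inv]
          ring
      · simp [hk]
    have hC : (∑ j ∈ range n, ∑ k ∈ range j,
        if 0 < k then 1 / (k : ℝ) * (1 / ((n : ℝ) ^ (p + 1) * (n - j))) else 0) =
        1 / (n : ℝ) ^ (p + 1) * ∑ j ∈ range n, hsum j * (1 / ((n : ℝ) - j)) := by
      rw [Finset.mul_sum]
      refine Finset.sum_congr rfl fun j _ => ?_
      rw [hsum, Finset.sum_mul, Finset.mul_sum]
      refine Finset.sum_congr rfl fun k _ => ?_
      rcases Nat.eq_zero_or_pos k with rfl | hk
      · simp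
      · rw [if_pos hk]
        simp only [one_div, mul_inv]
        ring
    have hH0 := hsum_nonneg n
    have hH1 := hsum_nonneg (n + 1)
    have hC0 : 0 ≤ ∑ j ∈ range n, hsum j * (1 / ((n : ℝ) - j)) :=
      Finset.sum_nonneg fun j hj =>
        mul_nonneg (hsum_nonneg j) (one_div_sub_nonneg n j (by simpa using hj))
    rw [tsum_congr hA, tsum_ite_lt_eq_sum_range,
      ← ENNReal.ofReal_sum_of_nonneg fun k _ => by positivity, hC,
      ← ENNReal.ofReal_add (Finset.sum_nonneg fun _ _ => by positivity)
        (Finset.sum_nonneg fun _ _ => by positivity),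
      ← ENNReal.ofReal_add (add_nonneg (Finset.sum_nonneg fun _ _ => by positivity)
        (Finset.sum_nonneg fun _ _ => by positivity)) (by positivity)]
    congr 1
    have h := sum_hsum_div_sub n
    rw [← Finset.mul_sum, ← hsum, hsum_succ, eq_sub_of_add_eq h]
    simp only [← one_div_mul_one_div, ← Finset.mul_sum, pow_one]
    rw [← hsum]
    field_simp
    ring
  · intro m n k hn hk
    have := one_div_sub_nonneg m n hn
    rw [← one_div_mul_one_div]
    positivity

theorem one_div_pow_mul_le (m : ℕ) {q : ℕ} (hq : 2 ≤ q) {c : ℝ} (hc : 0 ≤ c) :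
    1 / (m : ℝ) ^ q * c ≤ 1 / (m : ℝ) ^ 2 * c := by
  refine mul_le_mul_of_nonneg_right ?_ hc
  rcases Nat.eq_zero_or_pos m with rfl | hm
  · simp [show q ≠ 0 by omega]
  · exact one_div_le_one_div_of_le (by positivity)
      (pow_le_pow_right₀ (by exact_mod_cast hm) hq)

theorem one_div_pow_le_one_div {n : ℕ} (hn : 0 < n) {q : ℕ} (hq : 1 ≤ q) :
    1 / (n : ℝ) ^ q ≤ 1 / (n : ℝ) :=
  one_div_le_one_div_of_le (by positivity)
    (le_self_pow₀ (by exact_mod_cast hn) (by omega))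

theorem tripleSum_one_div_ne_top {a b c : ℕ} (ha : 2 ≤ a) (hb : 1 ≤ b) (hc : 1 ≤ c) :
    tripleSum (fun m n k => 1 / ((m : ℝ) ^ a * (n : ℝ) ^ b * (k : ℝ) ^ c)) ≠ ⊤ := by
  refine tripleSum_ne_top (fun _ n => 1 / (n : ℝ)) (fun _ k => 1 / (k : ℝ))
    (fun _ _ _ => by positivity) (fun _ _ _ => by positivity)
    sum_range_one_div_le sum_range_one_div_le fun m n k hn hk hk0 => ?_
  have h1 := one_div_pow_le_one_div (hk0.trans hk) hb
  have h2 := one_div_pow_le_one_div hk0 hc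
  calc 1 / ((m : ℝ) ^ a * (n : ℝ) ^ b * (k : ℝ) ^ c)
      = 1 / (m : ℝ) ^ a * (1 / (n : ℝ) ^ b * (1 / (k : ℝ) ^ c)) := by
        simp only [one_div, mul_inv]
        ring
    _ ≤ 1 / (m : ℝ) ^ a * (1 / (n : ℝ) * (1 / (k : ℝ))) := by gcongr
    _ ≤ _ := one_div_pow_mul_le m ha (by positivity)

theorem tripleSum_inner_remainder_ne_top {q : ℕ} (hq : 2 ≤ q) :
    tripleSum (fun m n k => 1 / (n : ℝ) * (1 / ((m : ℝ) ^ q * (m - k)))) ≠ ⊤ := by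
  refine tripleSum_ne_top (fun _ n => 1 / (n : ℝ)) (fun m k => 1 / ((m : ℝ) - k))
    (fun _ _ _ => by positivity) one_div_sub_nonneg
    sum_range_one_div_le (fun m => (sum_one_div_sub m).le) fun m n k hn hk _ => ?_
  have := one_div_sub_nonneg m k (hk.trans hn)
  calc 1 / (n : ℝ) * (1 / ((m : ℝ) ^ q * (m - k)))
      = 1 / (m : ℝ) ^ q * (1 / (n : ℝ) * (1 / ((m : ℝ) - k))) := by
        simp only [one_div, mul_inv]
        ring
    _ ≤ _ := one_div_pow_mul_le m hq (by positivity)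

theorem tripleSum_middle_remainder_ne_top {q : ℕ} (hq : 2 ≤ q) :
    tripleSum (fun m n k => 1 / (k : ℝ) * (1 / ((m : ℝ) ^ q * (m - n)))) ≠ ⊤ := by
  refine tripleSum_ne_top (fun m n => 1 / ((m : ℝ) - n)) (fun _ k => 1 / (k : ℝ))
    one_div_sub_nonneg (fun _ _ _ => by positivity)
    (fun m => (sum_one_div_sub m).le) sum_range_one_div_le fun m n k hn hk _ => ?_
  have := one_div_sub_nonneg m n hn
  calc 1 / (k : ℝ) * (1 / ((m : ℝ) ^ q * (m - n)))
      = 1 / (m : ℝ) ^ q * (1 / ((m : ℝ) - n) * (1 / (k : ℝ))) := by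
        simp only [one_div, mul_inv]
        ring
    _ ≤ _ := one_div_pow_mul_le m hq (by positivity)

theorem sum_tripleSum_inner (p : ℕ) :
    (∑ a ∈ Icc 2 (p + 1),
      tripleSum fun m n k => 1 / ((m : ℝ) ^ a * (n : ℝ) ^ 1 * (k : ℝ) ^ (p + 2 - a))) +
      tripleSum (fun m n k => 1 / (n : ℝ) * (1 / ((m : ℝ) ^ (p + 1) * (m - k)))) =
    tripleSum (fun m n k => 1 / (n : ℝ) * (1 / ((m : ℝ) * (m - k) * (k : ℝ) ^ p))) := by
  rw [← tripleSum_sum _ fun _ _ _ _ => by positivity, ← tripleSum_add]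
  · refine tripleSum_congr fun m n k hn hk hk0 => ?_
    have h1 : (0 : ℝ) < k := by exact_mod_cast hk0
    have h2 : (k : ℝ) < m := by exact_mod_cast hk.trans hn
    rw [← sum_one_div_pow_add (by linarith) (by linarith) (by linarith), mul_add, Finset.mul_sum]
    congr 1
    refine Finset.sum_congr rfl fun a _ => ?_
    simp only [one_div, mul_inv, pow_one]
    ring
  · intro m n k _ _ _
    exact Finset.sum_nonneg fun _ _ => by positivity
  · intro m n k hn hk _
    have := one_div_sub_nonneg m k (by omega)
    rw [← one_div_mul_one_div]
    positivity

theorem sum_tripleSum_middle (p : ℕ) :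
    (∑ a ∈ Icc 2 (p + 1),
      tripleSum fun m n k => 1 / ((m : ℝ) ^ a * (n : ℝ) ^ (p + 2 - a) * (k : ℝ) ^ 1)) +
      tripleSum (fun m n k => 1 / (k : ℝ) * (1 / ((m : ℝ) ^ (p + 1) * (m - n)))) =
    tripleSum (fun m n k => 1 / (k : ℝ) * (1 / ((m : ℝ) * (m - n) * (n : ℝ) ^ p))) := by
  rw [← tripleSum_sum _ fun _ _ _ _ => by positivity, ← tripleSum_add]
  · refine tripleSum_congr fun m n k hn hk hk0 => ?_
    have h1 : (0 : ℝ) < n := by exact_mod_cast hk0.trans hk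
    have h2 : (n : ℝ) < m := by exact_mod_cast hn
    rw [← sum_one_div_pow_add (by linarith) (by linarith) (by linarith), mul_add, Finset.mul_sum]
    congr 1
    refine Finset.sum_congr rfl fun a _ => ?_
    simp only [one_div, mul_inv, pow_one]
    ring
  · intro m n k _ _ _
    exact Finset.sum_nonneg fun _ _ => by positivity
  · intro m n k hn hk _
    have := one_div_sub_nonneg m n hn
    rw [← one_div_mul_one_div]
    positivity

theorem toReal_sum_eq_add {ι : Type*} {s : Finset ι} {f : ι → ENNReal} {x y r z : ENNReal}
    (hf : ∀ i ∈ s, f i ≠ ⊤) (hr : r ≠ ⊤) (h : ∑ i ∈ s, f i + r = z) (hz : z = x + y + r) :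
    ∑ i ∈ s, (f i).toReal = x.toReal + y.toReal := by
  have hxy : ∑ i ∈ s, f i = x + y := (ENNReal.add_left_inj hr).1 (h.trans hz)
  have hx : x + y ≠ ⊤ := hxy ▸ ENNReal.sum_ne_top.2 hf
  rw [← ENNReal.toReal_sum hf, hxy, ENNReal.toReal_add (ENNReal.add_ne_top.1 hx).1
    (ENNReal.add_ne_top.1 hx).2]

theorem granville_hoffman_ohno (l : ℕ) (hl : 4 ≤ l) :
    (∑ l1 ∈ Finset.Icc 2 (l - 2), tz l1 1 (l - 1 - l1)) = dz (l - 1) 1 + dz 2 (l - 2) ∧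
    (∑ l1 ∈ Finset.Icc 2 (l - 2), tz l1 (l - 1 - l1) 1) = dz (l - 1) 1 + dz (l - 2) 2 := by
  obtain ⟨p, rfl⟩ : ∃ p, l = p + 3 := ⟨l - 3, by omega⟩
  simp only [tz_eq_toReal, dz_eq_toReal, show p + 3 - 2 = p + 1 by omega,
    show p + 3 - 1 = p + 2 by omega]
  refine ⟨toReal_sum_eq_add (fun a ha => ?_)
      (tripleSum_inner_remainder_ne_top (by omega : 2 ≤ p + 1))
      (sum_tripleSum_inner p) (tripleSum_outer_inner p),
    toReal_sum_eq_add (fun a ha => ?_)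
      (tripleSum_middle_remainder_ne_top (by omega : 2 ≤ p + 1))
      (sum_tripleSum_middle p) (tripleSum_outer_middle p)⟩ <;>
  · have ha := Finset.mem_Icc.1 ha
    exact tripleSum_one_div_ne_top (by omega) (by omega) (by omega)
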